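/- arXiv:1710.05241 — 4 statements merged into one kernel-verified Lean document; each statement's English description precedes it below -/
import Mathlib

section
/- Suppose the identity (L₊/2)(z^{k+1} − z^k) − W e^{k+1} = −Q(r^{k+1} − r*) − (1/(2c))(∇f(x^{k+1}) − ∇f(x*)) holds, that ‖∇f(x^{k+1}) − ∇f(x*)‖ ≤ L‖x^{k+1} − x*‖ (L-smoothness), and that r^{k+1} − r* is orthogonal to ker Q. Then for all λ₁ > 1 and λ₂ > 1: (σ²_max(L₊)/4) ‖z^{k+1} − z^k‖² + ((λ₁ − 1)L² / (4c²)) ‖x^{k+1} − x*‖² ≥ (1 − 1/λ₁)(1 − 1/λ₂) σ²_min(Q) ‖r^{k+1} − r*‖² − (1 − 1/λ₁)(λ₂ − 1) σ²_max(W) ‖e^{k+1}‖². -/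
open scoped RealInnerProductSpace

/-- Peter–Paul (weighted Young) lower bound for the squared norm of a difference. -/
theorem one_sub_inv_mul_norm_sq_sub_le_norm_sub_sq {E : Type*} [NormedAddCommGroup E]
    [InnerProductSpace ℝ E] (u v : E) {t : ℝ} (ht : 0 < t) :
    (1 - 1 / t) * ‖u‖ ^ 2 - (t - 1) * ‖v‖ ^ 2 ≤ ‖u - v‖ ^ 2 := by
  have h : 0 ≤ 1 / t * ‖u - t • v‖ ^ 2 := by positivity
  have key : 1 / t * ‖u - t • v‖ ^ 2 = 1 / t * ‖u‖ ^ 2 - 2 * ⟪u, v⟫ + t * ‖v‖ ^ 2 := by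
    rw [norm_sub_sq_real, real_inner_smul_right, norm_smul, Real.norm_eq_abs, abs_of_pos ht]
    field_simp
  rw [norm_sub_sq_real]
  linarith

/-- Spectral inequality from the proof of Theorem 2: if the centered identity
`(L₊/2)(z^{k+1} − z^k) − W e^{k+1} = −Q(r^{k+1} − r*) − (1/(2c))(∇f(x^{k+1}) − ∇f(x*))`
holds, the gradient is `L`-Lipschitz, and `r^{k+1} − r*` is orthogonal to
`ker Q`, then for all `λ₁, λ₂ > 1`,
`(σ²_max(L₊)/4)‖z^{k+1}−z^k‖² + ((λ₁−1)L²/(4c²))‖x^{k+1}−x*‖²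
  ≥ (1−1/λ₁)(1−1/λ₂)σ²_min(Q)‖r^{k+1}−r*‖² − (1−1/λ₁)(λ₂−1)σ²_max(W)‖e^{k+1}‖²`. -/
theorem erroneous_admm_spectral_lower_bound
    {n : ℕ} (c L : ℝ) (hc : 0 < c) (hL : 0 < L)
    (Lp Lm W Q : EuclideanSpace ℝ (Fin n) →ₗ[ℝ] EuclideanSpace ℝ (Fin n))
    (hLp_sym : ∀ u w : EuclideanSpace ℝ (Fin n), ⟪Lp u, w⟫ = ⟪u, Lp w⟫)
    (hLm_sym : ∀ u w : EuclideanSpace ℝ (Fin n), ⟪Lm u, w⟫ = ⟪u, Lm w⟫)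
    (hW_sym : ∀ u w : EuclideanSpace ℝ (Fin n), ⟪W u, w⟫ = ⟪u, W w⟫)
    (hQ_sym : ∀ u w : EuclideanSpace ℝ (Fin n), ⟪Q u, w⟫ = ⟪u, Q w⟫)
    (hLp_psd : ∀ u : EuclideanSpace ℝ (Fin n), 0 ≤ ⟪u, Lp u⟫)
    (hLm_psd : ∀ u : EuclideanSpace ℝ (Fin n), 0 ≤ ⟪u, Lm u⟫)
    (hW_psd : ∀ u : EuclideanSpace ℝ (Fin n), 0 ≤ ⟪u, W u⟫)
    (hQ_psd : ∀ u : EuclideanSpace ℝ (Fin n), 0 ≤ ⟪u, Q u⟫)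
    (hW : W = (2⁻¹ : ℝ) • (Lp + Lm))
    (hQsq : Q ∘ₗ Q = (2⁻¹ : ℝ) • Lm)
    (f : EuclideanSpace ℝ (Fin n) → ℝ)
    (g : EuclideanSpace ℝ (Fin n) → EuclideanSpace ℝ (Fin n))
    (hf : ∀ p, HasGradientAt f (g p) p)
    (z0 z1 x1 xstar e1 r1 rstar : EuclideanSpace ℝ (Fin n))
    -- the centered identity
    (hid : (2⁻¹ : ℝ) • Lp (z1 - z0) - W e1
      = -(Q (r1 - rstar)) - (1 / (2 * c)) • (g x1 - g xstar))
    -- `L`-smoothness, applied at `x^{k+1}` and `x*`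
    (hLip : ‖g x1 - g xstar‖ ≤ L * ‖x1 - xstar‖)
    -- `r^{k+1} − r*` is orthogonal to `ker Q`
    (horth : ∀ w : EuclideanSpace ℝ (Fin n), Q w = 0 → ⟪r1 - rstar, w⟫ = 0)
    -- spectral constants
    (smaxLp smaxW sminQ : ℝ)
    (hsmaxLp : ∀ u : EuclideanSpace ℝ (Fin n), ‖Lp u‖ ^ 2 ≤ smaxLp * ‖u‖ ^ 2)
    (hsmaxW : ∀ u : EuclideanSpace ℝ (Fin n), ‖W u‖ ^ 2 ≤ smaxW * ‖u‖ ^ 2)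
    (hsminQ_pos : 0 < sminQ)
    (hsminQ : ∀ u : EuclideanSpace ℝ (Fin n),
      (∀ w, Q w = 0 → ⟪u, w⟫ = 0) → sminQ * ‖u‖ ^ 2 ≤ ‖Q u‖ ^ 2) :
    ∀ lam₁ lam₂ : ℝ, 1 < lam₁ → 1 < lam₂ →
      (1 - 1 / lam₁) * (1 - 1 / lam₂) * sminQ * ‖r1 - rstar‖ ^ 2
          - (1 - 1 / lam₁) * (lam₂ - 1) * smaxW * ‖e1‖ ^ 2
        ≤ smaxLp / 4 * ‖z1 - z0‖ ^ 2
          + (lam₁ - 1) * L ^ 2 / (4 * c ^ 2) * ‖x1 - xstar‖ ^ 2 := by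
  intro lam₁ lam₂ h₁ h₂
  have hpos : 0 ≤ 1 - 1 / lam₁ := by
    rw [sub_nonneg, div_le_one (by linarith)]
    exact h₁.le
  have hpos' : 0 ≤ 1 - 1 / lam₂ := by
    rw [sub_nonneg, div_le_one (by linarith)]
    exact h₂.le
  have outer := one_sub_inv_mul_norm_sq_sub_le_norm_sub_sq (Q (r1 - rstar) - W e1)
    (-((1 / (2 * c)) • (g x1 - g xstar))) (t := lam₁) (by linarith)
  have inner := one_sub_inv_mul_norm_sq_sub_le_norm_sub_sq (Q (r1 - rstar)) (W e1)
    (t := lam₂) (by linarith)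
  have hdiff : Q (r1 - rstar) - W e1 - -((1 / (2 * c)) • (g x1 - g xstar))
      = -((2⁻¹ : ℝ) • Lp (z1 - z0)) := by
    rw [sub_eq_iff_eq_add.mp hid]
    abel
  have hLp : ‖(2⁻¹ : ℝ) • Lp (z1 - z0)‖ ^ 2 ≤ smaxLp / 4 * ‖z1 - z0‖ ^ 2 := by
    rw [norm_smul, mul_pow, Real.norm_eq_abs, sq_abs]
    linarith [hsmaxLp (z1 - z0)]
  have hgrad : ‖(1 / (2 * c)) • (g x1 - g xstar)‖ ^ 2
      ≤ L ^ 2 / (4 * c ^ 2) * ‖x1 - xstar‖ ^ 2 := by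
    rw [norm_smul, mul_pow, Real.norm_eq_abs, sq_abs]
    calc (1 / (2 * c)) ^ 2 * ‖g x1 - g xstar‖ ^ 2
        ≤ (1 / (2 * c)) ^ 2 * (L * ‖x1 - xstar‖) ^ 2 := by gcongr
      _ = L ^ 2 / (4 * c ^ 2) * ‖x1 - xstar‖ ^ 2 := by
          field_simp
          ring
  rw [hdiff, norm_neg, norm_neg] at outer
  have hQ := mul_le_mul_of_nonneg_left (hsminQ (r1 - rstar) horth) hpos'
  have hWe := mul_le_mul_of_nonneg_left (hsmaxW e1) (sub_nonneg.mpr h₂.le)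
  have hinner := mul_le_mul_of_nonneg_left
    (show (1 - 1 / lam₂) * (sminQ * ‖r1 - rstar‖ ^ 2) - (lam₂ - 1) * (smaxW * ‖e1‖ ^ 2)
      ≤ ‖Q (r1 - rstar) - W e1‖ ^ 2 by linarith) hpos
  have hg := mul_le_mul_of_nonneg_left hgrad (sub_nonneg.mpr h₁.le)
  calc _ = (1 - 1 / lam₁) * ((1 - 1 / lam₂) * (sminQ * ‖r1 - rstar‖ ^ 2)
          - (lam₂ - 1) * (smaxW * ‖e1‖ ^ 2)) := by ring
    _ ≤ smaxLp / 4 * ‖z1 - z0‖ ^ 2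
          + (lam₁ - 1) * (L ^ 2 / (4 * c ^ 2) * ‖x1 - xstar‖ ^ 2) := by linarith
    _ = _ := by ring
end

section
/- Assume the inequality of the preceding lemma (Lemma 8) holds at every iteration k with constants δ > 0, P ≥ 0, b ∈ (0,1), λ₄ > 1, and that 0 < β ≤ b(1+δ) σ²_min(L₊)(1 − 1/λ₄) / ( 4b σ²_min(L₊)(1 − 1/λ₄) + 16 σ²_max(W) ), β < (1+δ)/4, and (1−b) σ²_min(L₊) ≤ (1+4β) σ²_max(L₊). Then for every k ≥ 1: ‖z^k − z*‖² ≤ B^k ( A + Σ_{s=1}^{k} B^{−s} C ‖e^s‖² ), where A := ‖z^0 − z*‖² + A₂‖r^0 − r*‖², A₂ := 4/((1+4β) σ²_max(L₊)), B := (1+4β) σ²_max(L₊) / ( (1−b)(1+δ−4β) σ²_min(L₊) ), and C := (4P + 2/β)/( c²(1−b)(1+δ−4β) σ²_min(L₊) ) + b(λ₄ − 1)/(1−b). -/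
/-- Discrete Grönwall inequality with constant factor `B > 0` and perturbation `w`. -/
lemma le_pow_mul_add_sum_of_le_mul_add {B : ℝ} (hB : 0 < B) {V w : ℕ → ℝ}
    (h : ∀ k, V (k + 1) ≤ B * V k + w (k + 1)) (k : ℕ) :
    V k ≤ B ^ k * (V 0 + ∑ s ∈ Finset.Icc 1 k, (B ^ s)⁻¹ * w s) := by
  induction k with
  | zero => simp
  | succ k ih =>
    rw [Finset.sum_Icc_succ_top (by omega)]
    calc V (k + 1) ≤ B * V k + w (k + 1) := h k
      _ ≤ B * (B ^ k * (V 0 + ∑ s ∈ Finset.Icc 1 k, (B ^ s)⁻¹ * w s)) + w (k + 1) := by gcongr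
      _ = _ := by field_simp; ring


/-- Theorem 3 of the paper: under the per-iteration inequality of Lemma 8 and
the stated choice of `β`, the erroneous update `z^k` approaches a neighborhood
of the minimizer linearly:
`‖z^k − z*‖² ≤ B^k (A + Σ_{s=1}^k B^{−s} C ‖e^s‖²)`. -/
theorem erroneous_admm_linear_neighborhood_convergence
    {n : ℕ} (c : ℝ) (hc : 0 < c)
    (δ P b lam₄ β : ℝ)
    (hδ : 0 < δ) (hP : 0 ≤ P) (hb0 : 0 < b) (hb1 : b < 1) (hlam₄ : 1 < lam₄)
    -- spectral constants
    (smaxLp smaxW sminLp : ℝ)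
    (hsminLp_pos : 0 < sminLp) (hsmaxW_nonneg : 0 ≤ smaxW)
    -- constraints on β
    (hβ0 : 0 < β)
    (hβ : β ≤ b * (1 + δ) * sminLp * (1 - 1 / lam₄)
            / (4 * b * sminLp * (1 - 1 / lam₄) + 16 * smaxW))
    (hβ' : β < (1 + δ) / 4)
    (hA : (1 - b) * sminLp ≤ (1 + 4 * β) * smaxLp)
    -- sequences
    (z x e r : ℕ → EuclideanSpace ℝ (Fin n))
    (hz : ∀ k, z k = x k + e k)
    (zstar xstar rstar : EuclideanSpace ℝ (Fin n)) (hzstar : zstar = xstar)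
    -- the inequality of Lemma 8, at every iteration
    (hstep : ∀ k : ℕ,
      (1 - b) * (1 / 4 - β / (1 + δ)) * sminLp * ‖z (k + 1) - zstar‖ ^ 2
          + (1 - 4 * β / (1 + δ)) * ‖r (k + 1) - rstar‖ ^ 2
          + b * (1 / 4 - β / (1 + δ)) * sminLp * (1 - 1 / lam₄)
              * ‖x (k + 1) - xstar‖ ^ 2
        ≤ ((1 / 4 + β) / (1 + δ)) * smaxLp * ‖z k - zstar‖ ^ 2
          + (1 / (1 + δ)) * ‖r k - rstar‖ ^ 2
          + ((P + 1 / (2 * β)) / ((1 + δ) * c ^ 2)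
              + b * (1 / 4 - β / (1 + δ)) * sminLp * (lam₄ - 1)) * ‖e (k + 1)‖ ^ 2
          + (4 * β * smaxW / (1 + δ)) * ‖x (k + 1) - xstar‖ ^ 2) :
    ∀ k : ℕ, 1 ≤ k →
      ‖z k - zstar‖ ^ 2
        ≤ ((1 + 4 * β) * smaxLp / ((1 - b) * (1 + δ - 4 * β) * sminLp)) ^ k
            * ((‖z 0 - zstar‖ ^ 2
                  + (4 / ((1 + 4 * β) * smaxLp)) * ‖r 0 - rstar‖ ^ 2)
              + ∑ s ∈ Finset.Icc 1 k,
                  (((1 + 4 * β) * smaxLp / ((1 - b) * (1 + δ - 4 * β) * sminLp))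
                      ^ s)⁻¹
                    * (((4 * P + 2 / β)
                          / (c ^ 2 * (1 - b) * (1 + δ - 4 * β) * sminLp)
                        + b * (lam₄ - 1) / (1 - b)) * ‖e s‖ ^ 2)) := by
  have hδ1 : 0 < 1 + δ := by linarith
  have hD : 0 < 1 + δ - 4 * β := by linarith
  have hb : 0 < 1 - b := by linarith
  have hlam : 0 < 1 - 1 / lam₄ := by
    rw [sub_pos, div_lt_one (by linarith)]
    exact hlam₄
  have hmin : 0 < (1 - b) * sminLp := by positivity
  have hmax : 0 < (1 + 4 * β) * smaxLp := hmin.trans_le hA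
  have hden : 0 < (1 - b) * (1 + δ - 4 * β) * sminLp := by positivity
  have hW : 16 * β * smaxW ≤ b * (1 + δ - 4 * β) * sminLp * (1 - 1 / lam₄) := by
    rw [le_div_iff₀ (by positivity)] at hβ
    linarith
  have hweight : 4 / ((1 + 4 * β) * smaxLp) ≤ 4 / ((1 - b) * sminLp) := by gcongr
  intro k _
  refine le_trans (le_add_of_nonneg_right (by positivity)) <|
    le_pow_mul_add_sum_of_le_mul_add
      (V := fun k => ‖z k - zstar‖ ^ 2 + 4 / ((1 + 4 * β) * smaxLp) * ‖r k - rstar‖ ^ 2)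
      (w := fun s => ((4 * P + 2 / β) / (c ^ 2 * (1 - b) * (1 + δ - 4 * β) * sminLp)
        + b * (lam₄ - 1) / (1 - b)) * ‖e s‖ ^ 2)
      (div_pos hmax hden) (fun j => ?_) k
  have hscaled : (1 - b) * (1 + δ - 4 * β) * sminLp * ‖z (j + 1) - zstar‖ ^ 2
        + 4 * (1 + δ - 4 * β) * ‖r (j + 1) - rstar‖ ^ 2
        + b * (1 + δ - 4 * β) * sminLp * (1 - 1 / lam₄) * ‖x (j + 1) - xstar‖ ^ 2
      ≤ (1 + 4 * β) * smaxLp * ‖z j - zstar‖ ^ 2 + 4 * ‖r j - rstar‖ ^ 2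
        + ((4 * P + 2 / β) / c ^ 2 + b * (1 + δ - 4 * β) * sminLp * (lam₄ - 1))
          * ‖e (j + 1)‖ ^ 2
        + 16 * β * smaxW * ‖x (j + 1) - xstar‖ ^ 2 := by
    refine Eq.trans_le ?_ ((mul_le_mul_of_nonneg_left (hstep j)
      (by positivity : 0 ≤ 4 * (1 + δ))).trans_eq ?_) <;> field_simp <;> ring
  have hx := mul_le_mul_of_nonneg_right hW (sq_nonneg ‖x (j + 1) - xstar‖)
  have hr := mul_le_mul_of_nonneg_right hweight (sq_nonneg ‖r (j + 1) - rstar‖)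
  refine (add_le_add_right hr _).trans (le_of_mul_le_mul_left ?_ hden)
  calc (1 - b) * (1 + δ - 4 * β) * sminLp *
        (‖z (j + 1) - zstar‖ ^ 2 + 4 / ((1 - b) * sminLp) * ‖r (j + 1) - rstar‖ ^ 2)
      = (1 - b) * (1 + δ - 4 * β) * sminLp * ‖z (j + 1) - zstar‖ ^ 2
        + 4 * (1 + δ - 4 * β) * ‖r (j + 1) - rstar‖ ^ 2 := by field_simp
    _ ≤ (1 + 4 * β) * smaxLp * ‖z j - zstar‖ ^ 2 + 4 * ‖r j - rstar‖ ^ 2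
        + ((4 * P + 2 / β) / c ^ 2 + b * (1 + δ - 4 * β) * sminLp * (lam₄ - 1))
          * ‖e (j + 1)‖ ^ 2 := by linarith
    _ = _ := by
      have hmax' : smaxLp ≠ 0 := right_ne_zero_of_mul hmax.ne'
      field_simp
end

section
/- Let v, L > 0, q > 0, a ∈ (0,1), and for t > 0 define δ(t) := a · 2vq t / (L² t + 2v). Then for every t > 0 the inequality t (1 + δ(t)) > 1 holds if and only if t > 4v / ( √( (L² + 2v)² + 16 v² a q ) − L² + 2v ). (Here t plays the role of σ²_min(L₊)/σ²_max(L₊), q of σ²_min(Q), and a of (λ₂−1)/λ₂, so this is the equivalence between the convergence condition (1+δ)σ²_min(L₊) > σ²_max(L₊) and the network-design condition (8) of the paper.) -/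
/-- Equivalence between the convergence condition `(1+δ)σ²_min(L₊) > σ²_max(L₊)`
and the network-design condition (8) of the paper: with
`δ(t) = a·2vqt/(L²t + 2v)`, for every `t > 0` one has `t(1 + δ(t)) > 1` iff
`t > 4v/(√((L²+2v)² + 16v²aq) − L² + 2v)`. -/
theorem network_design_condition_iff
    (v L q a : ℝ) (hv : 0 < v) (hL : 0 < L) (hq : 0 < q)
    (ha0 : 0 < a) (ha1 : a < 1) :
    ∀ t : ℝ, 0 < t →
      (t * (1 + a * (2 * v * q * t) / (L ^ 2 * t + 2 * v)) > 1 ↔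
        t > 4 * v /
          (Real.sqrt ((L ^ 2 + 2 * v) ^ 2 + 16 * v ^ 2 * a * q)
            - L ^ 2 + 2 * v)) := by
  intro t ht
  set S := Real.sqrt ((L ^ 2 + 2 * v) ^ 2 + 16 * v ^ 2 * a * q)
  have hvaq : 0 < v ^ 2 * a * q := by positivity
  have hvL : 0 < v * L ^ 2 := by positivity
  have hSsq : S ^ 2 = (L ^ 2 + 2 * v) ^ 2 + 16 * v ^ 2 * a * q :=
    Real.sq_sqrt (by positivity)
  obtain ⟨hlow, hupp⟩ : -S < L ^ 2 - 2 * v ∧ L ^ 2 - 2 * v < S :=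
    abs_lt.mp (abs_lt_of_sq_lt_sq (by nlinarith) (Real.sqrt_nonneg _))
  have hden : 0 < L ^ 2 * t + 2 * v := by positivity
  have hfactor : 0 < t * S + (4 * v - (2 * v - L ^ 2) * t) := by
    nlinarith [mul_pos ht (show 0 < S + L ^ 2 - 2 * v by linarith)]
  have hsub : t * (1 + a * (2 * v * q * t) / (L ^ 2 * t + 2 * v)) - 1 =
      (t * S - (4 * v - (2 * v - L ^ 2) * t)) *
        ((t * S + (4 * v - (2 * v - L ^ 2) * t)) / (8 * v * (L ^ 2 * t + 2 * v))) := by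
    field_simp
    linear_combination (-t ^ 2) * hSsq
  rw [gt_iff_lt, gt_iff_lt, div_lt_iff₀ (by linarith), ← sub_pos, hsub,
    mul_pos_iff_of_pos_right (by positivity), ← sub_pos (b := 4 * v)]
  ring_nf
end

section
/- Let f be convex and differentiable and suppose the decentralized ADMM iteration runs without errors (e^k = 0, so z^k = x^k, for all k). Then for every T ≥ 1, with x̂_T := (1/T) Σ_{k=1}^{T} x^k, the function-value residual satisfies f(x̂_T) − f(x*) ≤ (c/T) ( ⟨x^0 − x*, (L₊/2)(x^0 − x*)⟩ + ‖r^0‖² ), where r^0 = Q x^0; i.e., error-free decentralized ADMM converges at rate O(1/T). -/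
open scoped RealInnerProductSpace

section Preliminaries

variable {E : Type*} [NormedAddCommGroup E] [InnerProductSpace ℝ E]

/-- A convex function lies above its tangent hyperplanes. -/
theorem ConvexOn.sub_le_inner_of_hasGradientAt [CompleteSpace E] {f : E → ℝ} {p f' : E}
    (hf : ConvexOn ℝ Set.univ f) (hp : HasGradientAt f f' p) (y : E) :
    f p - f y ≤ ⟪f', p - y⟫ := by
  have hline : HasDerivAt (AffineMap.lineMap p y : ℝ → E) (y - p) 0 :=
    AffineMap.hasDerivAt_lineMap
  have hfp : HasFDerivAt f (InnerProductSpace.toDual ℝ E f')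
      ((AffineMap.lineMap p y : ℝ → E) 0) := by
    simpa using hp.hasFDerivAt
  have hslope := (hf.comp_affineMap (AffineMap.lineMap p y : ℝ →ᵃ[ℝ] E)).le_slope_of_hasDerivAt
    (Set.mem_univ 0) (Set.mem_univ 1) zero_lt_one (hfp.comp_hasDerivAt 0 hline)
  simp only [slope_def_field, InnerProductSpace.toDual_apply_apply, Function.comp_apply,
    AffineMap.lineMap_apply_one, AffineMap.lineMap_apply_zero, sub_zero, div_one] at hslope
  rw [← neg_sub y p, inner_neg_right]
  linarith

/-- Young's inequality for a positive semidefinite form. -/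
theorem two_mul_inner_sub_le {A : E →ₗ[ℝ] E} (hsym : ∀ u v : E, ⟪A u, v⟫ = ⟪u, A v⟫)
    (hpsd : ∀ u : E, 0 ≤ ⟪u, A u⟫) (a b : E) :
    2 * ⟪A (a - b), b⟫ ≤ ⟪a, A a⟫ - ⟪b, A b⟫ := by
  have h := hpsd (a - b)
  have hab : ⟪A a, b⟫ = ⟪b, A a⟫ := real_inner_comm _ _
  have hba := hsym a b
  have hbb := hsym b b
  simp only [map_sub, inner_sub_left, inner_sub_right] at h ⊢
  linarith

/-- One ADMM step from `x` to `x'`, where `s` is the accumulated disagreement before the step. -/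
theorem admm_step [CompleteSpace E] {c : ℝ} (hc : 0 < c) {Lp Lm Q : E →ₗ[ℝ] E}
    (hLp_sym : ∀ u v : E, ⟪Lp u, v⟫ = ⟪u, Lp v⟫) (hQ_sym : ∀ u v : E, ⟪Q u, v⟫ = ⟪u, Q v⟫)
    (hLp_psd : ∀ u : E, 0 ≤ ⟪u, Lp u⟫) (hLm : ∀ u, Lm u = (2 : ℝ) • Q (Q u))
    {f : E → ℝ} (hconv : ConvexOn ℝ Set.univ f) {x x' g s y : E} (hg : HasGradientAt f g x')
    (hstep : g + (2 * c) • Q s + c • (Lp x' + Lm x') = c • Lp x) (hy : Q y = 0) :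
    f x' - f y + c / 2 * ⟪x' - y, Lp (x' - y)⟫ + c * ‖s + Q x'‖ ^ 2
      ≤ c / 2 * ⟪x - y, Lp (x - y)⟫ + c * ‖s‖ ^ 2 := by
  have hgap := hconv.sub_le_inner_of_hasGradientAt hg y
  have hg_eq : g = c • Lp (x - x') - (2 * c) • Q s - (2 * c) • Q (Q x') := by
    rw [hLm] at hstep
    rw [eq_sub_of_add_eq (eq_sub_of_add_eq hstep), map_sub]
    module
  have hQ : Q (x' - y) = Q x' := by rw [map_sub, hy, sub_zero]
  have hsplit : ⟪g, x' - y⟫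
      = c * ⟪Lp (x - x'), x' - y⟫ - 2 * c * ⟪s, Q x'⟫ - 2 * c * ‖Q x'‖ ^ 2 := by
    rw [hg_eq, inner_sub_left, inner_sub_left, real_inner_smul_left, real_inner_smul_left,
      real_inner_smul_left, hQ_sym, hQ_sym, hQ, real_inner_self_eq_norm_sq]
  have hyoung := two_mul_inner_sub_le hLp_sym hLp_psd (x - y) (x' - y)
  rw [sub_sub_sub_cancel_right] at hyoung
  rw [norm_add_sq_real]
  nlinarith [mul_le_mul_of_nonneg_left hyoung hc.le, mul_nonneg hc.le (sq_nonneg ‖Q x'‖)]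

end Preliminaries

/-- Error-free decentralized ADMM converges at rate `O(1/T)` for convex `f`:
with `x̂_T = (1/T) Σ_{k=1}^T x^k`,
`f(x̂_T) − f(x*) ≤ (c/T)(⟨x⁰ − x*, (L₊/2)(x⁰ − x*)⟩ + ‖r⁰‖²)` where `r⁰ = Q x⁰`. -/
theorem error_free_admm_sublinear_rate
    {n : ℕ} (c : ℝ) (hc : 0 < c)
    (Lp Lm W Q : EuclideanSpace ℝ (Fin n) →ₗ[ℝ] EuclideanSpace ℝ (Fin n))
    (hLp_sym : ∀ u v : EuclideanSpace ℝ (Fin n), ⟪Lp u, v⟫ = ⟪u, Lp v⟫)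
    (hLm_sym : ∀ u v : EuclideanSpace ℝ (Fin n), ⟪Lm u, v⟫ = ⟪u, Lm v⟫)
    (hW_sym : ∀ u v : EuclideanSpace ℝ (Fin n), ⟪W u, v⟫ = ⟪u, W v⟫)
    (hQ_sym : ∀ u v : EuclideanSpace ℝ (Fin n), ⟪Q u, v⟫ = ⟪u, Q v⟫)
    (hLp_psd : ∀ u : EuclideanSpace ℝ (Fin n), 0 ≤ ⟪u, Lp u⟫)
    (hLm_psd : ∀ u : EuclideanSpace ℝ (Fin n), 0 ≤ ⟪u, Lm u⟫)
    (hW_psd : ∀ u : EuclideanSpace ℝ (Fin n), 0 ≤ ⟪u, W u⟫)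
    (hQ_psd : ∀ u : EuclideanSpace ℝ (Fin n), 0 ≤ ⟪u, Q u⟫)
    (hW : W = (2⁻¹ : ℝ) • (Lp + Lm))
    (hQsq : Q ∘ₗ Q = (2⁻¹ : ℝ) • Lm)
    (f : EuclideanSpace ℝ (Fin n) → ℝ)
    (g : EuclideanSpace ℝ (Fin n) → EuclideanSpace ℝ (Fin n))
    (hf : ∀ p, HasGradientAt f (g p) p)
    (hconv : ConvexOn ℝ Set.univ f)
    (x α : ℕ → EuclideanSpace ℝ (Fin n))
    (hα0 : α 0 = 0)
    (hup1 : ∀ k, g (x (k + 1)) + α k + (2 * c) • W (x (k + 1)) = c • Lp (x k))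
    (hup2 : ∀ k, α (k + 1) = α k + c • Lm (x (k + 1)))
    (r : ℕ → EuclideanSpace ℝ (Fin n))
    (hr : ∀ k, r k = ∑ s ∈ Finset.range (k + 1), Q (x s))
    (xstar : EuclideanSpace ℝ (Fin n))
    (hxstar_feas : Q xstar = 0)
    (hxstar_min : ∀ y : EuclideanSpace ℝ (Fin n), Q y = 0 → f xstar ≤ f y)
    (T : ℕ) (hT : 1 ≤ T) :
    f ((T : ℝ)⁻¹ • ∑ k ∈ Finset.Icc 1 T, x k) - f xstar
      ≤ (c / (T : ℝ))
          * (⟪x 0 - xstar, (2⁻¹ : ℝ) • Lp (x 0 - xstar)⟫ + ‖r 0‖ ^ 2) := by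
  have hLm : ∀ u, Lm u = (2 : ℝ) • Q (Q u) := fun u => by
    rw [← LinearMap.comp_apply, hQsq, LinearMap.smul_apply, smul_inv_smul₀ two_ne_zero]
  have hα : ∀ k, α k = (2 * c) • Q (∑ i ∈ Finset.range k, Q (x (i + 1))) := by
    intro k
    induction k with
    | zero => simp [hα0]
    | succ k ih =>
      rw [hup2, ih, hLm, Finset.sum_range_succ, map_add]
      module
  have hstep : ∀ k, g (x (k + 1)) + (2 * c) • Q (∑ i ∈ Finset.range k, Q (x (i + 1)))
      + c • (Lp (x (k + 1)) + Lm (x (k + 1))) = c • Lp (x k) := by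
    intro k
    rw [← hα, ← hup1 k, hW, LinearMap.smul_apply, LinearMap.add_apply]
    module
  have hsum : ∀ m, ∑ k ∈ Finset.range m, (f (x (k + 1)) - f xstar)
      + c / 2 * ⟪x m - xstar, Lp (x m - xstar)⟫
      + c * ‖∑ i ∈ Finset.range m, Q (x (i + 1))‖ ^ 2
      ≤ c / 2 * ⟪x 0 - xstar, Lp (x 0 - xstar)⟫ := by
    intro m
    induction m with
    | zero => simp
    | succ m ih =>
      have h := admm_step hc hLp_sym hQ_sym hLp_psd hLm hconv (hf _) (hstep m) hxstar_feas
      rw [Finset.sum_range_succ, Finset.sum_range_succ]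
      linarith
  have hT0 : (0 : ℝ) < T := by exact_mod_cast hT
  have hIcc : ∑ k ∈ Finset.Icc 1 T, x k = ∑ k ∈ Finset.range T, x (k + 1) := by
    rw [Finset.range_eq_Ico, Finset.sum_Ico_add' x 0 T 1, zero_add, Finset.Ico_add_one_right_eq_Icc]
  have hjensen : f ((T : ℝ)⁻¹ • ∑ k ∈ Finset.Icc 1 T, x k)
      ≤ (T : ℝ)⁻¹ * ∑ k ∈ Finset.range T, f (x (k + 1)) := by
    rw [hIcc, Finset.smul_sum, Finset.mul_sum]
    refine hconv.map_sum_le (fun _ _ => by positivity) ?_ (fun _ _ => Set.mem_univ _)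
    simp [hT0.ne']
  have hbound : ∑ k ∈ Finset.range T, f (x (k + 1)) - T * f xstar
      ≤ c * (⟪x 0 - xstar, (2⁻¹ : ℝ) • Lp (x 0 - xstar)⟫ + ‖r 0‖ ^ 2) := by
    have h := hsum T
    rw [Finset.sum_sub_distrib, Finset.sum_const, Finset.card_range, nsmul_eq_mul] at h
    rw [real_inner_smul_right]
    have hLpT := mul_nonneg hc.le (hLp_psd (x T - xstar))
    have hsT := mul_nonneg hc.le (sq_nonneg ‖∑ i ∈ Finset.range T, Q (x (i + 1))‖)
    have hr0 := mul_nonneg hc.le (sq_nonneg ‖r 0‖)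
    linarith
  calc f ((T : ℝ)⁻¹ • ∑ k ∈ Finset.Icc 1 T, x k) - f xstar
      ≤ (T : ℝ)⁻¹ * ∑ k ∈ Finset.range T, f (x (k + 1)) - f xstar := sub_le_sub_right hjensen _
    _ = (T : ℝ)⁻¹ * (∑ k ∈ Finset.range T, f (x (k + 1)) - T * f xstar) := by field_simp
    _ ≤ (T : ℝ)⁻¹ * (c * (⟪x 0 - xstar, (2⁻¹ : ℝ) • Lp (x 0 - xstar)⟫ + ‖r 0‖ ^ 2)) := by gcongr
    _ = _ := by ring
end
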